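/- arXiv:2506.07186 — 4 statements merged into one kernel-verified Lean document; each statement's English description precedes it below -/
import Mathlib

section
/- Fixed-point characterization of the inducible value set (Proposition 4.2): For every state s ∈ S and every vector 𝐯 ∈ ℝ^{n+1}, one has 𝐯 ∈ 𝒱*(s) if and only if there exist π̄ ∈ Δ(𝐀) and 𝐰 : 𝐀 × 𝐀 × S → ℝ^{n+1} with (π̄,𝐰) ∈ F_s(𝒱*) such that 𝐯 = Bellman(s,π̄,𝐰); equivalently, 𝒱* = Φ(𝒱*). -/
open Finset

/-- A probability mass function on a finite type, as a predicate. -/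
def IsDist {X : Type*} [Fintype X] (f : X → ℝ) : Prop :=
  (∀ x, 0 ≤ f x) ∧ ∑ x, f x = 1

/-- Data of a stochastic game with a principal (player `0`) and `n` agents
(players `1,…,n`): initial state, discount factor, transition function and
reward functions. -/
structure Game (S A : Type*) (n : ℕ) where
  sInit : S
  gamma : ℝ
  p : S → (Fin (n + 1) → A) → S → ℝ
  r : Fin (n + 1) → S → (Fin (n + 1) → A) → ℝ

/-- Validity of the game data: `γ ∈ [0,1)`, transitions are probability
distributions, and rewards lie in `[-(1-γ)/2, (1-γ)/2]`. -/
def Game.Valid {S A : Type*} [Fintype S] {n : ℕ} (G : Game S A n) : Prop :=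
  0 ≤ G.gamma ∧ G.gamma < 1 ∧ (∀ s a, IsDist (G.p s a)) ∧
    ∀ i s a, |G.r i s a| ≤ (1 - G.gamma) / 2

/-- Histories: finite sequences of (state, recommended joint action, played joint action). -/
abbrev Hist (S A : Type*) (n : ℕ) :=
  List (S × (Fin (n + 1) → A) × (Fin (n + 1) → A))

/-- A (history-dependent) correlation policy assigns a probability distribution on
joint actions to every history and current state. -/
def IsPolicy {S A : Type*} [Fintype A] {n : ℕ}
    (π : Hist S A n → S → (Fin (n + 1) → A) → ℝ) : Prop :=
  ∀ σ s, IsDist (π σ s)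

/-- The trivial deviation plan (no deviation). -/
def noDev {S A : Type*} {n : ℕ} : Hist S A n → S → A → A := fun _ _ a => a

/-- `IsValueFn G π i ρ V Q` says that `V` and `Q` are bounded functions satisfying
the Bellman-type recursion defining the V- and Q-values induced by the policy `π`
together with the deviation plan `ρ` of agent `i`. -/
def IsValueFn {S A : Type*} [Fintype S] [Fintype A] {n : ℕ}
    (G : Game S A n) (π : Hist S A n → S → (Fin (n + 1) → A) → ℝ)
    (i : Fin (n + 1)) (ρ : Hist S A n → S → A → A)
    (V : Hist S A n → S → Fin (n + 1) → ℝ)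
    (Q : Hist S A n → S → (Fin (n + 1) → A) → Fin (n + 1) → ℝ) : Prop :=
  (∃ C : ℝ, ∀ σ s j, |V σ s j| ≤ C) ∧
  (∀ σ s j, V σ s j = ∑ a : Fin (n + 1) → A, π σ s a * Q σ s a j) ∧
  (∀ σ s (a : Fin (n + 1) → A) j,
    Q σ s a j =
      G.r j s (Function.update a i (ρ σ s (a i))) +
        G.gamma * ∑ s', G.p s (Function.update a i (ρ σ s (a i))) s' *
          V (σ ++ [(s, a, Function.update a i (ρ σ s (a i)))]) s' j)

/-- `π` is a `δ`-correlated equilibrium: it is a policy, and for every agent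
`i ∈ {1,…,n}`, every history, state and recommended action, no deviation plan
improves the agent's conditional value by more than `δ`. -/
def IsCE {S A : Type*} [Fintype S] [Fintype A] [DecidableEq A] {n : ℕ}
    (G : Game S A n) (δ : ℝ)
    (π : Hist S A n → S → (Fin (n + 1) → A) → ℝ) : Prop :=
  IsPolicy π ∧
  ∀ V Q, IsValueFn G π 0 noDev V Q →
    ∀ i : Fin (n + 1), i ≠ 0 →
      ∀ (ρ : Hist S A n → S → A → A) Vρ Qρ, IsValueFn G π i ρ Vρ Qρ →
        ∀ (σ : Hist S A n) (s : S) (a : A),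
          ∑ av ∈ univ.filter (fun av : Fin (n + 1) → A => av i = a),
              π σ s av * Q σ s av i ≥
            ∑ av ∈ univ.filter (fun av : Fin (n + 1) → A => av i = a),
              π σ s av * Qρ σ s av i - δ

/-- A value vector `v` is `δ`-inducible at state `s` if `v = V^π(s)` for some `δ`-CE `π`. -/
def Inducible {S A : Type*} [Fintype S] [Fintype A] [DecidableEq A] {n : ℕ}
    (G : Game S A n) (δ : ℝ) (s : S) (v : Fin (n + 1) → ℝ) : Prop :=
  ∃ π V Q, IsCE G δ π ∧ IsValueFn G π 0 noDev V Q ∧ V [] s = v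

/-- The inducible value set `𝒱*(s)`: all values inducible (by exact CEs) at `s`. -/
def Vstar {S A : Type*} [Fintype S] [Fintype A] [DecidableEq A] {n : ℕ}
    (G : Game S A n) : S → Set (Fin (n + 1) → ℝ) :=
  fun s => {v | Inducible G 0 s v}

/-- One-step Bellman value of a stage distribution `pb` and onward values `w`. -/
def Bellman {S A : Type*} [Fintype S] [Fintype A] {n : ℕ}
    (G : Game S A n) (s : S) (pb : (Fin (n + 1) → A) → ℝ)
    (w : (Fin (n + 1) → A) → (Fin (n + 1) → A) → S → Fin (n + 1) → ℝ) :
    Fin (n + 1) → ℝ :=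
  fun j => ∑ a : Fin (n + 1) → A,
    pb a * (G.r j s a + G.gamma * ∑ s', G.p s a s' * w a a s' j)

/-- The incentive-compatibility constraint for a stage distribution `pb` and
onward values `w` at state `s`. -/
def ICC {S A : Type*} [Fintype S] [Fintype A] [DecidableEq A] {n : ℕ}
    (G : Game S A n) (s : S) (pb : (Fin (n + 1) → A) → ℝ)
    (w : (Fin (n + 1) → A) → (Fin (n + 1) → A) → S → Fin (n + 1) → ℝ) : Prop :=
  ∀ i : Fin (n + 1), i ≠ 0 → ∀ a b : A,
    ∑ av ∈ univ.filter (fun av : Fin (n + 1) → A => av i = a),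
        pb av * (G.r i s av + G.gamma * ∑ s', G.p s av s' * w av av s' i) ≥
      ∑ av ∈ univ.filter (fun av : Fin (n + 1) → A => av i = a),
        pb av * (G.r i s (Function.update av i b) +
          G.gamma * ∑ s', G.p s (Function.update av i b) s' *
            w av (Function.update av i b) s' i)

/-- The feasible set `F_s(𝒱)` of pairs `(pb, w)`. -/
def Feas {S A : Type*} [Fintype S] [Fintype A] [DecidableEq A] {n : ℕ}
    (G : Game S A n) (s : S) (VS : S → Set (Fin (n + 1) → ℝ)) :
    Set (((Fin (n + 1) → A) → ℝ) ×
      ((Fin (n + 1) → A) → (Fin (n + 1) → A) → S → Fin (n + 1) → ℝ)) :=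
  {pw | IsDist pw.1 ∧ ICC G s pw.1 pw.2 ∧ ∀ a b s', pw.2 a b s' ∈ VS s'}

/-- The update map `Φ` on value-set functions. -/
def Phi {S A : Type*} [Fintype S] [Fintype A] [DecidableEq A] {n : ℕ}
    (G : Game S A n) (VS : S → Set (Fin (n + 1) → ℝ)) :
    S → Set (Fin (n + 1) → ℝ) :=
  fun s => {v | ∃ pb w, (pb, w) ∈ Feas G s VS ∧ v = Bellman G s pb w}

/-- The hypercube `B = [-1/2, 1/2]^{n+1}`. -/
def cube (n : ℕ) : Set (Fin (n + 1) → ℝ) := {v | ∀ i, |v i| ≤ 1 / 2}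

/-- The `ξ`-neighborhood (in `‖·‖_∞`) of a set of value vectors. -/
def neigh {n : ℕ} (ξ : ℝ) (X : Set (Fin (n + 1) → ℝ)) : Set (Fin (n + 1) → ℝ) :=
  {v' | ∃ v ∈ X, ∀ i, |v' i - v i| ≤ ξ}

/-- The grid `G_ξ` of vectors whose coordinates are integer multiples of `ξ`. -/
def grid (n : ℕ) (ξ : ℝ) : Set (Fin (n + 1) → ℝ) :=
  {v | ∀ i, ∃ m : ℤ, v i = ξ * (m : ℝ)}

/-- The approximate update map `Φ̂`. -/
def PhiHat {S A : Type*} [Fintype S] [Fintype A] [DecidableEq A] {n : ℕ}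
    (G : Game S A n) (ξ : ℝ) (VS : S → Set (Fin (n + 1) → ℝ)) :
    S → Set (Fin (n + 1) → ℝ) :=
  fun s => convexHull ℝ (neigh ξ (Phi G VS s) ∩ grid n ξ)

/-- Pushing a new state into a `λ`-step memory. -/
def shiftMem {S : Type*} {lam : ℕ} (m : Fin lam → Option S) (s : S) :
    Fin lam → Option S :=
  fun j => if (j : ℕ) = 0 then some s
    else m ⟨(j : ℕ) - 1, lt_of_le_of_lt (Nat.sub_le _ _) j.isLt⟩

/-- The `λ`-memory meta-game: meta-states record the current state together with
the previous `λ` states (with `none` as placeholder). -/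
def metaGame {S A : Type*} [DecidableEq S] {n : ℕ} (G : Game S A n) (lam : ℕ) :
    Game ((Fin lam → Option S) × S) A n where
  sInit := (fun _ => none, G.sInit)
  gamma := G.gamma
  p := fun x a x' => if x'.1 = shiftMem x.1 x.2 then G.p x.2 a x'.2 else 0
  r := fun i x a => G.r i x.2 a

/-- The game is `c`-turn-based with acting-player sets `I s` (always containing
the principal `0`): rewards and transitions only depend on acting players' actions. -/
def TurnBased {S A : Type*} {n : ℕ} (G : Game S A n) (c : ℕ)
    (I : S → Finset (Fin (n + 1))) : Prop :=
  (∀ s, (I s).card ≤ c) ∧ (∀ s, (0 : Fin (n + 1)) ∈ I s) ∧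
    ∀ s (a a' : Fin (n + 1) → A), (∀ i ∈ I s, a i = a' i) →
      (∀ j, G.r j s a = G.r j s a') ∧ ∀ s', G.p s a s' = G.p s a' s'

/-- The set of acting players recorded in a meta-state. -/
def metaI {S : Type*} {n lam : ℕ} (I : S → Finset (Fin (n + 1)))
    (x : (Fin lam → Option S) × S) : Finset (Fin (n + 1)) :=
  I x.2 ∪ Finset.univ.biUnion fun j : Fin lam => (x.1 j).elim ∅ I

/-- The relaxed neighborhood `neigh_{ξ₂}^{Ix}`: coordinates in `Ix` must stay
`ξ₂`-close, the others are only required to lie in `neigh_{ξ₂}(B)`. -/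
def neighI {n : ℕ} (ξ₂ : ℝ) (Ix : Finset (Fin (n + 1)))
    (X : Set (Fin (n + 1) → ℝ)) : Set (Fin (n + 1) → ℝ) :=
  {v' | v' ∈ neigh ξ₂ (cube n) ∧ ∃ v ∈ X, ∀ i ∈ Ix, |v' i - v i| ≤ ξ₂}

/-- The turn-based approximate update map `Φ^TB` on value-set functions of the
`λ`-memory meta-game. -/
def PhiTB {S A : Type*} [Fintype S] [Fintype A] [DecidableEq S] [DecidableEq A]
    {n : ℕ} (G : Game S A n) (lam : ℕ) (I : S → Finset (Fin (n + 1))) (ξ : ℝ)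
    (VS : ((Fin lam → Option S) × S) → Set (Fin (n + 1) → ℝ)) :
    ((Fin lam → Option S) × S) → Set (Fin (n + 1) → ℝ) :=
  fun x => convexHull ℝ
    (neighI (ξ / 2) (metaI I x) (Phi (metaGame G lam) VS x) ∩ grid n (ξ / 2))

/-- The auxiliary value function of the repeated 2×2 zero-sum subgame. -/
noncomputable def vfun (x y : ℝ) : ℝ :=
  (x * y + 2 * (1 - x) * (1 - y)) / (1 - x * y / 2 - (1 - x) * (1 - y) / 2)

open Filter Topology

section Distributions

variable {X : Type*} [Fintype X]

theorem IsDist.abs_sum_mul_le {f : X → ℝ} (hf : IsDist f) {g : X → ℝ} {c : ℝ}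
    (hg : ∀ x, |g x| ≤ c) : |∑ x, f x * g x| ≤ c := by
  calc |∑ x, f x * g x| ≤ ∑ x, |f x * g x| := abs_sum_le_sum_abs _ _
    _ ≤ ∑ x, f x * c := by
        refine sum_le_sum fun x _ => ?_
        rw [abs_mul, abs_of_nonneg (hf.1 x)]
        exact mul_le_mul_of_nonneg_left (hg x) (hf.1 x)
    _ = c := by rw [← sum_mul, hf.2, one_mul]

end Distributions

section Histories

variable {S A : Type*} {n : ℕ}

/-- The first state visited by a play with history `σ` and current state `s`. -/
def firstState (σ : Hist S A n) (s : S) : S :=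
  match σ with
  | [] => s
  | x :: _ => x.1

theorem firstState_append (σ : Hist S A n) (s s' : S) (a b : Fin (n + 1) → A) :
    firstState (σ ++ [(s, a, b)]) s' = firstState σ s := by
  cases σ <;> rfl

theorem IsPolicy.tail [Fintype A] {π : Hist S A n → S → (Fin (n + 1) → A) → ℝ}
    (hπ : IsPolicy π) (x : S × (Fin (n + 1) → A) × (Fin (n + 1) → A)) :
    IsPolicy fun σ => π (x :: σ) :=
  fun _ => hπ _

end Histories

section ValueFunctions

variable {S A : Type*} [Fintype S] [Fintype A] {n : ℕ}

/-- The Q-values obtained from onward values `V` under agent `i`'s deviation plan `ρ`. -/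
def actionValue (G : Game S A n) (i : Fin (n + 1)) (ρ : Hist S A n → S → A → A)
    (V : Hist S A n → S → Fin (n + 1) → ℝ) (σ : Hist S A n) (s : S)
    (a : Fin (n + 1) → A) (j : Fin (n + 1)) : ℝ :=
  G.r j s (Function.update a i (ρ σ s (a i))) +
    G.gamma * ∑ s', G.p s (Function.update a i (ρ σ s (a i))) s' *
      V (σ ++ [(s, a, Function.update a i (ρ σ s (a i)))]) s' j

/-- The Bellman operator of a policy `π` under agent `i`'s deviation plan `ρ`. -/
def policyStep (G : Game S A n) (π : Hist S A n → S → (Fin (n + 1) → A) → ℝ)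
    (i : Fin (n + 1)) (ρ : Hist S A n → S → A → A)
    (V : Hist S A n → S → Fin (n + 1) → ℝ) (σ : Hist S A n) (s : S)
    (j : Fin (n + 1)) : ℝ :=
  ∑ a, π σ s a * actionValue G i ρ V σ s a j

variable {G : Game S A n} {π : Hist S A n → S → (Fin (n + 1) → A) → ℝ}
  {i : Fin (n + 1)} {ρ : Hist S A n → S → A → A}
  {V V' : Hist S A n → S → Fin (n + 1) → ℝ}
  {Q Q' : Hist S A n → S → (Fin (n + 1) → A) → Fin (n + 1) → ℝ}

theorem IsValueFn.eq_actionValue (h : IsValueFn G π i ρ V Q) : Q = actionValue G i ρ V := by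
  funext σ s a j
  exact h.2.2 σ s a j

theorem IsValueFn.eq_policyStep (h : IsValueFn G π i ρ V Q) : V = policyStep G π i ρ V := by
  funext σ s j
  rw [h.2.1 σ s j, h.eq_actionValue]
  rfl

theorem abs_policyStep_sub_le (hG : G.Valid) (hπ : IsPolicy π) {D : ℝ}
    (h : ∀ σ s j, |V σ s j - V' σ s j| ≤ D) (σ : Hist S A n) (s : S) (j : Fin (n + 1)) :
    |policyStep G π i ρ V σ s j - policyStep G π i ρ V' σ s j| ≤ G.gamma * D := by
  unfold policyStep
  rw [← sum_sub_distrib]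
  simp_rw [← mul_sub]
  refine (hπ σ s).abs_sum_mul_le fun a => ?_
  unfold actionValue
  rw [add_sub_add_left_eq_sub, ← mul_sub, ← sum_sub_distrib, abs_mul, abs_of_nonneg hG.1]
  simp_rw [← mul_sub]
  exact mul_le_mul_of_nonneg_left ((hG.2.2.1 _ _).abs_sum_mul_le fun s' => h _ _ _) hG.1

theorem abs_policyStep_le (hG : G.Valid) (hπ : IsPolicy π)
    (h : ∀ σ s j, |V σ s j| ≤ 1 / 2) (σ : Hist S A n) (s : S) (j : Fin (n + 1)) :
    |policyStep G π i ρ V σ s j| ≤ 1 / 2 := by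
  refine (hπ σ s).abs_sum_mul_le fun a => (abs_add_le _ _).trans ?_
  have h₁ := hG.2.2.2 j s (Function.update a i (ρ σ s (a i)))
  have h₂ := (hG.2.2.1 s (Function.update a i (ρ σ s (a i)))).abs_sum_mul_le
    fun s' => h (σ ++ [(s, a, Function.update a i (ρ σ s (a i)))]) s' j
  rw [abs_mul, abs_of_nonneg hG.1]
  have h₃ := mul_le_mul_of_nonneg_left h₂ hG.1
  linarith

theorem IsValueFn.value_unique (hG : G.Valid) (hπ : IsPolicy π)
    (h : IsValueFn G π i ρ V Q) (h' : IsValueFn G π i ρ V' Q') : V = V' := by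
  obtain ⟨C, hC⟩ := h.1
  obtain ⟨C', hC'⟩ := h'.1
  have key : ∀ k : ℕ, ∀ σ s j, |V σ s j - V' σ s j| ≤ G.gamma ^ k * (C + C') := by
    intro k
    induction k with
    | zero =>
      intro σ s j
      rw [pow_zero, one_mul]
      exact (abs_sub _ _).trans (add_le_add (hC σ s j) (hC' σ s j))
    | succ k ih =>
      intro σ s j
      rw [h.eq_policyStep, h'.eq_policyStep, pow_succ', mul_assoc]
      exact abs_policyStep_sub_le hG hπ ih σ s j
  funext σ s j
  have hlim : Tendsto (fun k : ℕ => G.gamma ^ k * (C + C')) atTop (𝓝 0) := by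
    simpa using (tendsto_pow_atTop_nhds_zero_of_lt_one hG.1 hG.2.1).mul_const (C + C')
  have h0 := ge_of_tendsto' hlim fun k => key k σ s j
  exact sub_eq_zero.1 (abs_nonpos_iff.1 h0)

theorem IsValueFn.action_unique (hG : G.Valid) (hπ : IsPolicy π)
    (h : IsValueFn G π i ρ V Q) (h' : IsValueFn G π i ρ V' Q') : Q = Q' := by
  rw [h.eq_actionValue, h'.eq_actionValue, h.value_unique hG hπ h']

theorem exists_isValueFn (hG : G.Valid) (hπ : IsPolicy π) (i : Fin (n + 1))
    (ρ : Hist S A n → S → A → A) : ∃ V Q, IsValueFn G π i ρ V Q := by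
  let W : ℕ → Hist S A n → S → Fin (n + 1) → ℝ := fun k =>
    (policyStep G π i ρ)^[k] fun _ _ _ => 0
  have hW : ∀ k, W (k + 1) = policyStep G π i ρ (W k) := fun k =>
    Function.iterate_succ_apply' _ _ _
  have hb : ∀ k σ s j, |W k σ s j| ≤ 1 / 2 := by
    intro k
    induction k with
    | zero => intro σ s j; simp [W]
    | succ k ih => rw [hW]; exact abs_policyStep_le hG hπ ih
  have hd : ∀ k σ s j, |W k σ s j - W (k + 1) σ s j| ≤ G.gamma ^ k * 1 := by
    intro k
    induction k with
    | zero =>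
      intro σ s j
      have h := (abs_sub (W 0 σ s j) (W 1 σ s j)).trans (add_le_add (hb 0 σ s j) (hb 1 σ s j))
      norm_num at h ⊢
      exact h
    | succ k ih =>
      intro σ s j
      rw [hW (k + 1), pow_succ', mul_assoc]
      nth_rewrite 1 [hW k]
      exact abs_policyStep_sub_le hG hπ ih σ s j
  have hlim : ∀ σ s j, ∃ x, Tendsto (fun k => W k σ s j) atTop (𝓝 x) := by
    intro σ s j
    refine cauchySeq_tendsto_of_complete
      (cauchySeq_of_le_geometric G.gamma 1 hG.2.1 fun k => ?_)
    rw [Real.dist_eq, one_mul]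
    simpa using hd k σ s j
  choose V hV using hlim
  refine ⟨V, actionValue G i ρ V, ⟨1 / 2, fun σ s j => ?_⟩, fun σ s j => ?_,
    fun σ s a j => rfl⟩
  · exact le_of_tendsto' (hV σ s j).abs fun k => hb k σ s j
  · refine tendsto_nhds_unique ((tendsto_add_atTop_iff_nat 1).2 (hV σ s j)) ?_
    simp_rw [hW]
    exact tendsto_finsetSum _ fun a _ => (tendsto_const_nhds.add
      ((tendsto_finsetSum _ fun s' _ => (hV _ _ _).const_mul _).const_mul _)).const_mul _

/-- A value function restricted to the histories extending a given first step is a value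
function of the continuation policy. -/
theorem IsValueFn.tail (h : IsValueFn G π i ρ V Q)
    (x : S × (Fin (n + 1) → A) × (Fin (n + 1) → A)) :
    IsValueFn G (fun σ => π (x :: σ)) i (fun σ => ρ (x :: σ))
      (fun σ => V (x :: σ)) (fun σ => Q (x :: σ)) :=
  ⟨h.1.imp fun _ hC _ => hC _, fun _ => h.2.1 _, fun _ => h.2.2 _⟩

theorem isValueFn_noDev_iff (i j : Fin (n + 1)) :
    IsValueFn G π i noDev V Q ↔ IsValueFn G π j noDev V Q := by
  simp only [IsValueFn, noDev, Function.update_eq_self]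

theorem isValueFn_firstState {P : S → Hist S A n → S → (Fin (n + 1) → A) → ℝ}
    {U : S → Hist S A n → S → Fin (n + 1) → ℝ}
    {R : S → Hist S A n → S → (Fin (n + 1) → A) → Fin (n + 1) → ℝ}
    (h : ∀ t, IsValueFn G (P t) i ρ (U t) (R t)) :
    IsValueFn G (fun σ s => P (firstState σ s) σ s) i ρ
      (fun σ s => U (firstState σ s) σ s) (fun σ s => R (firstState σ s) σ s) := by
  choose C hC using fun t => (h t).1
  refine ⟨⟨∑ t, |C t|, fun σ s j => ?_⟩, fun σ s => (h _).2.1 σ s, fun σ s a j => ?_⟩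
  · exact ((hC _ σ s j).trans (le_abs_self _)).trans
      (single_le_sum (f := fun t => |C t|) (fun t _ => abs_nonneg _) (mem_univ _))
  · simp only [firstState_append]
    exact (h _).2.2 σ s a j

end ValueFunctions

section Equilibria

variable {S A : Type*} [Fintype S] [Fintype A] [DecidableEq A] {n : ℕ}
  {G : Game S A n} {π : Hist S A n → S → (Fin (n + 1) → A) → ℝ}
  {i : Fin (n + 1)} {ρ : Hist S A n → S → A → A}
  {V V' : Hist S A n → S → Fin (n + 1) → ℝ}
  {Q Q' : Hist S A n → S → (Fin (n + 1) → A) → Fin (n + 1) → ℝ}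

theorem IsCE.tail (hG : G.Valid) {δ : ℝ} (hπ : IsCE G δ π)
    (x : S × (Fin (n + 1) → A) × (Fin (n + 1) → A)) :
    IsCE G δ fun σ => π (x :: σ) := by
  refine ⟨hπ.1.tail x, fun V Q hV i hi ρ Vρ Qρ hVρ σ s a => ?_⟩
  obtain ⟨U, R, hU⟩ := exists_isValueFn hG hπ.1 0 noDev
  obtain ⟨Uρ, Rρ, hUρ⟩ := exists_isValueFn hG hπ.1 i fun τ => ρ τ.tail
  rw [hV.action_unique hG (hπ.1.tail x) (hU.tail x),
    hVρ.action_unique hG (hπ.1.tail x) (hUρ.tail x)]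
  exact hπ.2 U R hU i hi _ Uρ Rρ hUρ (x :: σ) s a

theorem IsCE.deviation_value_le (hπ : IsCE G 0 π) (hV : IsValueFn G π 0 noDev V Q)
    (hi : i ≠ 0) (hV' : IsValueFn G π i ρ V' Q') (σ : Hist S A n) (s : S) :
    V' σ s i ≤ V σ s i := by
  rw [hV.2.1, hV'.2.1, ← sum_fiberwise univ (fun a => a i) fun a => π σ s a * Q σ s a i,
    ← sum_fiberwise univ (fun a => a i) fun a => π σ s a * Q' σ s a i]
  exact sum_le_sum fun a _ => by simpa using hπ.2 V Q hV i hi ρ V' Q' hV' σ s a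

theorem isCE_firstState (hG : G.Valid) {δ : ℝ}
    {P : S → Hist S A n → S → (Fin (n + 1) → A) → ℝ} (hP : ∀ t, IsCE G δ (P t)) :
    IsCE G δ fun σ s => P (firstState σ s) σ s := by
  have hpol : IsPolicy fun σ s => P (firstState σ s) σ s := fun σ s => (hP _).1 σ s
  refine ⟨hpol, fun V Q hV i hi ρ Vρ Qρ hVρ σ s a => ?_⟩
  choose U R hU using fun t => exists_isValueFn hG (hP t).1 0 noDev
  choose Uρ Rρ hUρ using fun t => exists_isValueFn hG (hP t).1 i ρ
  rw [hV.action_unique hG hpol (isValueFn_firstState hU),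
    hVρ.action_unique hG hpol (isValueFn_firstState hUρ)]
  exact (hP _).2 _ _ (hU _) i hi ρ _ _ (hUρ _) σ s a

/-- The policy that draws from `pb s` in the first step, and then follows a continuation policy
determined by that step. -/
def consPolicy (pb : S → (Fin (n + 1) → A) → ℝ)
    (P : S × (Fin (n + 1) → A) × (Fin (n + 1) → A) →
      Hist S A n → S → (Fin (n + 1) → A) → ℝ) :
    Hist S A n → S → (Fin (n + 1) → A) → ℝ
  | [] => pb
  | x :: σ => P x σ

theorem isCE_consPolicy (hG : G.Valid) {pb : S → (Fin (n + 1) → A) → ℝ}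
    {P : S × (Fin (n + 1) → A) × (Fin (n + 1) → A) →
      Hist S A n → S → (Fin (n + 1) → A) → ℝ}
    {U : S × (Fin (n + 1) → A) × (Fin (n + 1) → A) →
      Hist S A n → S → Fin (n + 1) → ℝ}
    {R : S × (Fin (n + 1) → A) × (Fin (n + 1) → A) →
      Hist S A n → S → (Fin (n + 1) → A) → Fin (n + 1) → ℝ}
    (hpb : ∀ s, IsDist (pb s)) (hP : ∀ x, IsCE G 0 (P x))
    (hU : ∀ x, IsValueFn G (P x) 0 noDev (U x) (R x))
    (hIC : ∀ s, ICC G s (pb s) fun a b => U (s, a, b) []) :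
    IsCE G 0 (consPolicy pb P) := by
  refine ⟨fun σ => ?_, fun V Q hV i hi ρ Vρ Qρ hVρ σ s a => ?_⟩
  · cases σ with
    | nil => exact hpb
    | cons x σ => exact (hP x).1 σ
  · cases σ with
    | cons x σ => exact (hP x).2 _ _ (hV.tail x) i hi _ _ _ (hVρ.tail x) σ s a
    | nil =>
      have hval : ∀ x, V [x] = U x [] := fun x =>
        congrFun ((hV.tail x).value_unique hG (hP x).1 (hU x)) []
      have hle : ∀ x s', Vρ [x] s' i ≤ U x [] s' i := fun x s' =>
        (hP x).deviation_value_le (hU x) hi (hVρ.tail x) [] s'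
      rw [sub_zero]
      refine ge_trans (ge_of_eq ?_) (ge_trans (hIC s i hi a (ρ [] s a)) ?_)
      · refine sum_congr rfl fun av _ => ?_
        rw [hV.2.2]
        simp [noDev, hval, consPolicy]
      · refine sum_le_sum fun av hav => ?_
        rw [← (mem_filter.1 hav).2, hVρ.2.2]
        refine mul_le_mul_of_nonneg_left ?_ ((hpb s).1 av)
        refine add_le_add_right (mul_le_mul_of_nonneg_left ?_ hG.1) _
        exact sum_le_sum fun s' _ =>
          mul_le_mul_of_nonneg_left (hle _ s') ((hG.2.2.1 _ _).1 s')

theorem Vstar_subset_Phi (hG : G.Valid) (s : S) : Vstar G s ⊆ Phi G (Vstar G) s := by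
  rintro v ⟨π, V, Q, hπ, hV, rfl⟩
  refine ⟨π [] s, fun a b => V [(s, a, b)], ⟨hπ.1 [] s, fun i hi a b => ?_,
    fun a b s' => ⟨_, _, _, hπ.tail hG (s, a, b), hV.tail (s, a, b), rfl⟩⟩, ?_⟩
  · let ρ : Hist S A n → S → A → A := fun σ s a => if σ = [] then b else a
    obtain ⟨Vρ, Qρ, hVρ⟩ := exists_isValueFn hG hπ.1 i ρ
    have hval : ∀ x, Vρ [x] = V [x] := fun x =>
      congrFun ((hVρ.tail x).value_unique hG (hπ.1.tail x)
        ((isValueFn_noDev_iff 0 i).1 (hV.tail x))) []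
    have h := hπ.2 V Q hV i hi ρ Vρ Qρ hVρ [] s a
    simpa [hV.2.2, hVρ.2.2, hval, noDev, ρ] using h
  · funext j
    rw [hV.2.1]
    simp [Bellman, hV.2.2, noDev]

theorem Phi_subset_Vstar (hG : G.Valid) (s : S) : Phi G (Vstar G) s ⊆ Vstar G s := by
  rintro v ⟨pb, w, hpw, rfl⟩
  have hne : Nonempty (Fin (n + 1) → A) := by
    by_contra h
    rw [not_nonempty_iff] at h
    simpa using hpw.1.2
  obtain ⟨a₀⟩ := hne
  have hstage : ∀ t, ∃ x ∈ Feas G t (Vstar G), t = s → x = (pb, w) := by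
    intro t
    by_cases hts : t = s
    · subst hts
      exact ⟨_, hpw, fun _ => rfl⟩
    · obtain ⟨pb', w', h, -⟩ := Vstar_subset_Phi hG t (hpw.2.2 a₀ a₀ t)
      exact ⟨_, h, fun h' => absurd h' hts⟩
  choose F hF hFs using hstage
  choose P U R hP hU hw using
    fun (x : S × (Fin (n + 1) → A) × (Fin (n + 1) → A)) t => (hF x.1).2.2 x.2.1 x.2.2 t
  have hglue := fun x => isValueFn_firstState (hU x)
  have hCE : IsCE G 0 (consPolicy (fun t => (F t).1)
      fun x σ t => P x (firstState σ t) σ t) := by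
    refine isCE_consPolicy hG (fun t => (hF t).1) (fun x => isCE_firstState hG (hP x)) hglue
      fun t => ?_
    convert (hF t).2.1 using 4 with a b t'
    exact hw (t, a, b) t'
  obtain ⟨V, Q, hV⟩ := exists_isValueFn hG hCE.1 0 noDev
  refine ⟨_, V, Q, hCE, hV, ?_⟩
  have hval : ∀ a b t, V [(s, a, b)] t = w a b t := by
    intro a b t
    have h := congrFun (congrFun ((hV.tail (s, a, b)).value_unique hG
      (isCE_firstState hG (hP (s, a, b))).1 (hglue (s, a, b))) []) t
    refine (h.trans (hw (s, a, b) t)).trans ?_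
    simp [hFs s rfl]
  funext j
  rw [hV.2.1]
  simp [Bellman, hV.2.2, noDev, hval, consPolicy, hFs s rfl]

end Equilibria

/-- Proposition 4.2: Fixed-point characterization of the
inducible value set: `v ∈ 𝒱*(s)` iff `v = Bellman(s, pb, w)` for some
`(pb, w) ∈ F_s(𝒱*)`; equivalently `𝒱* = Φ(𝒱*)`. -/
theorem stmt0 {S A : Type*} [Fintype S] [Fintype A] [DecidableEq A] {n : ℕ}
    (G : Game S A n) (hG : G.Valid) :
    (∀ (s : S) (v : Fin (n + 1) → ℝ),
      v ∈ Vstar G s ↔ ∃ pb w, (pb, w) ∈ Feas G s (Vstar G) ∧ v = Bellman G s pb w) ∧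
    Vstar G = Phi G (Vstar G) := by
  have h : ∀ s, Vstar G s = Phi G (Vstar G) s := fun s =>
    (Vstar_subset_Phi hG s).antisymm (Phi_subset_Vstar hG s)
  exact ⟨fun s v => Set.ext_iff.1 (h s) v, funext h⟩
end

section
/- The approximate map Φ̂ sandwiches Φ (Lemma 4.8): If a value-set function 𝒱 is such that 𝒱(s) is convex for every state s, then Φ(𝒱) ⊆ Φ̂(𝒱) ⊆ neigh_ξ(Φ(𝒱)), i.e., Φ(𝒱)(s) ⊆ Φ̂(𝒱)(s) ⊆ neigh_ξ(Φ(𝒱)(s)) for every s ∈ S. -/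
open Finset

/-- Splitting the mixed weight `a * x + b * y` into conditional probabilities of its two parts. -/
theorem exists_convex_weights_of_nonneg {a b x y : ℝ} (ha : 0 ≤ a) (hb : 0 ≤ b)
    (hx : 0 ≤ x) (hy : 0 ≤ y) :
    ∃ c d : ℝ, 0 ≤ c ∧ 0 ≤ d ∧ c + d = 1 ∧
      (a * x + b * y) * c = a * x ∧ (a * x + b * y) * d = b * y := by
  have hax := mul_nonneg ha hx
  have hby := mul_nonneg hb hy
  by_cases h : a * x + b * y = 0
  · refine ⟨1, 0, by norm_num, le_rfl, by norm_num, ?_, ?_⟩ <;> linarith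
  · refine ⟨a * x / (a * x + b * y), b * y / (a * x + b * y), by positivity, by positivity,
      ?_, ?_, ?_⟩ <;> field_simp

theorem IsDist.convex_comb {X : Type*} [Fintype X] {f g : X → ℝ} (hf : IsDist f)
    (hg : IsDist g) {a b : ℝ} (ha : 0 ≤ a) (hb : 0 ≤ b) (hab : a + b = 1) :
    IsDist fun x => a * f x + b * g x := by
  refine ⟨fun x => add_nonneg (mul_nonneg ha (hf.1 x)) (mul_nonneg hb (hg.1 x)), ?_⟩
  rw [Finset.sum_add_distrib, ← Finset.mul_sum, ← Finset.mul_sum, hf.2, hg.2, mul_one, mul_one,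
    hab]

/-- `Φ` maps convex value sets to convex value sets. -/
theorem convex_Phi {S A : Type*} [Fintype S] [Fintype A] [DecidableEq A] {n : ℕ}
    (G : Game S A n) {VS : S → Set (Fin (n + 1) → ℝ)} (hconv : ∀ s, Convex ℝ (VS s)) (s : S) :
    Convex ℝ (Phi G VS s) := by
  rintro _ ⟨p₁, w₁, ⟨hp₁, hic₁, hw₁⟩, rfl⟩ _ ⟨p₂, w₂, ⟨hp₂, hic₂, hw₂⟩, rfl⟩ a b ha hb hab
  dsimp only at hp₁ hic₁ hw₁ hp₂ hic₂ hw₂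
  choose c d hc hd hcd hqc hqd using fun av =>
    exists_convex_weights_of_nonneg ha hb (hp₁.1 av) (hp₂.1 av)
  let w : (Fin (n + 1) → A) → (Fin (n + 1) → A) → S → Fin (n + 1) → ℝ :=
    fun av bv s' => c av • w₁ av bv s' + d av • w₂ av bv s'
  have key : ∀ av bv i, (a * p₁ av + b * p₂ av) *
      (G.r i s bv + G.gamma * ∑ s', G.p s bv s' * w av bv s' i) =
      a * (p₁ av * (G.r i s bv + G.gamma * ∑ s', G.p s bv s' * w₁ av bv s' i)) +
      b * (p₂ av * (G.r i s bv + G.gamma * ∑ s', G.p s bv s' * w₂ av bv s' i)) := by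
    intro av bv i
    have hsum : ∑ s', G.p s bv s' * w av bv s' i =
        c av * ∑ s', G.p s bv s' * w₁ av bv s' i +
          d av * ∑ s', G.p s bv s' * w₂ av bv s' i := by
      rw [Finset.mul_sum, Finset.mul_sum, ← Finset.sum_add_distrib]
      refine Finset.sum_congr rfl fun s' _ => ?_
      simp only [w, Pi.add_apply, Pi.smul_apply, smul_eq_mul]
      ring
    rw [hsum]
    linear_combination
      (G.gamma * ∑ s', G.p s bv s' * w₁ av bv s' i) * hqc av +
      (G.gamma * ∑ s', G.p s bv s' * w₂ av bv s' i) * hqd av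
  refine ⟨fun av => a * p₁ av + b * p₂ av, w,
    ⟨hp₁.convex_comb hp₂ ha hb hab, ?_, fun av bv s' =>
      hconv s' (hw₁ av bv s') (hw₂ av bv s') (hc av) (hd av) (hcd av)⟩, ?_⟩
  · intro i hi x y
    simp only [key, Finset.sum_add_distrib, ← Finset.mul_sum]
    exact add_le_add (mul_le_mul_of_nonneg_left (hic₁ i hi x y) ha)
      (mul_le_mul_of_nonneg_left (hic₂ i hi x y) hb)
  · funext j
    simp only [Bellman, key, Finset.sum_add_distrib, ← Finset.mul_sum, Pi.add_apply,
      Pi.smul_apply, smul_eq_mul]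

theorem convex_neigh {n : ℕ} {ξ : ℝ} {X : Set (Fin (n + 1) → ℝ)} (hX : Convex ℝ X) :
    Convex ℝ (neigh ξ X) := by
  rintro x ⟨u, hu, hxu⟩ y ⟨v, hv, hyv⟩ a b ha hb hab
  refine ⟨a • u + b • v, hX hu hv ha hb hab, fun i => ?_⟩
  simp only [Pi.add_apply, Pi.smul_apply, smul_eq_mul]
  have hx := abs_le.1 (hxu i)
  have hy := abs_le.1 (hyv i)
  obtain rfl : b = 1 - a := by linarith
  rw [abs_le]
  constructor <;> nlinarith

/-- Every point is a convex combination of the grid points within distance `ξ` of it. -/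
theorem mem_convexHull_neigh_singleton_inter_grid {n : ℕ} {ξ : ℝ} (hξ : 0 < ξ)
    (v : Fin (n + 1) → ℝ) : v ∈ convexHull ℝ (neigh ξ {v} ∩ grid n ξ) := by
  have hfloor : ∀ i, ξ * (⌊v i / ξ⌋ : ℝ) ≤ v i ∧ v i ≤ ξ * ((⌊v i / ξ⌋ : ℝ) + 1) := by
    intro i
    have hv : ξ * (v i / ξ) = v i := by field_simp
    constructor
    · exact (mul_le_mul_of_nonneg_left (Int.floor_le (v i / ξ)) hξ.le).trans_eq hv
    · exact hv.symm.trans_le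
        (mul_le_mul_of_nonneg_left (Int.lt_floor_add_one (v i / ξ)).le hξ.le)
  have hbox : v ∈ convexHull ℝ (Set.univ.pi fun i =>
      ({ξ * (⌊v i / ξ⌋ : ℝ), ξ * ((⌊v i / ξ⌋ : ℝ) + 1)} : Set ℝ)) := by
    rw [convexHull_pi]
    intro i _
    change v i ∈ convexHull ℝ _
    rw [convexHull_pair, segment_eq_Icc ((hfloor i).1.trans (hfloor i).2)]
    exact hfloor i
  refine convexHull_mono ?_ hbox
  refine fun u hu => ⟨⟨v, rfl, fun i => ?_⟩, fun i => ?_⟩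
  · have h := hfloor i
    rw [abs_le]
    rcases hu i trivial with hui | hui
    · rw [hui]; constructor <;> linarith
    · rw [Set.mem_singleton_iff.1 hui]; constructor <;> linarith
  · rcases hu i trivial with hui | hui
    · exact ⟨_, hui⟩
    · exact ⟨⌊v i / ξ⌋ + 1, by rw [Set.mem_singleton_iff.1 hui]; push_cast; rfl⟩

/-- Lemma 4.8: the approximate map `Φ̂` sandwiches `Φ`:
`Φ(𝒱) ⊆ Φ̂(𝒱) ⊆ neigh_ξ(Φ(𝒱))` whenever every `𝒱(s)` is convex. -/
theorem stmt6 {S A : Type*} [Fintype S] [Fintype A] [DecidableEq A] {n : ℕ}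
    (G : Game S A n) (hG : G.Valid) (ε δ ξ : ℝ) (hε : 0 < ε) (hδ : 0 < δ)
    (hξ : ξ = (1 - G.gamma) * min ε (δ / 2))
    (hdiv : ∃ m : ℕ, (1 / 2 : ℝ) = (m : ℝ) * ξ)
    (VS : S → Set (Fin (n + 1) → ℝ)) (hconv : ∀ s, Convex ℝ (VS s)) :
    ∀ s, Phi G VS s ⊆ PhiHat G ξ VS s ∧ PhiHat G ξ VS s ⊆ neigh ξ (Phi G VS s) := by
  have hξ_pos : 0 < ξ := by
    rw [hξ]
    exact mul_pos (sub_pos.2 hG.2.1) (lt_min hε (half_pos hδ))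
  refine fun s => ⟨fun v hv => ?_, ?_⟩
  · refine convexHull_mono ?_ (mem_convexHull_neigh_singleton_inter_grid hξ_pos v)
    rintro u ⟨⟨_, rfl, hu⟩, hgrid⟩
    exact ⟨⟨_, hv, hu⟩, hgrid⟩
  · exact convexHull_min Set.inter_subset_left (convex_neigh (convex_Phi G hconv s))
end

section
/- Irrational maximin value in the repeated 2×2 zero-sum subgame (core of Lemma A.1): Let v : [0,1] × [0,1] → ℝ be defined by v(x,y) = (x·y + 2·(1−x)·(1−y)) / (1 − x·y/2 − (1−x)·(1−y)/2). Then the minimum over x ∈ [0,1] of max{v(x,0), v(x,1)} equals √(11/3) − 1, and this minimum is attained at x = (7 − √33)/2; moreover, x = (7 − √33)/2 is the unique point of [0,1] at which v(x,0) = v(x,1). -/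
open Finset

theorem vfun_zero_right (x : ℝ) : vfun x 0 = 2 * (1 - x) / (1 - (1 - x) / 2) := by
  simp [vfun]

theorem vfun_one_right (x : ℝ) : vfun x 1 = x / (1 - x / 2) := by
  simp [vfun]

theorem vfun_zero_eq_vfun_one_iff {x : ℝ} (hx : x ∈ Set.Icc (0 : ℝ) 1) :
    vfun x 0 = vfun x 1 ↔ x = (7 - Real.sqrt 33) / 2 := by
  obtain ⟨h0, h1⟩ := hx
  have hs : Real.sqrt 33 ^ 2 = 33 := Real.sq_sqrt (by norm_num)
  rw [vfun_zero_right, vfun_one_right, div_eq_div_iff (by linarith) (by linarith)]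
  constructor
  · intro h
    have hprod : (x - (7 - Real.sqrt 33) / 2) * (x - (7 + Real.sqrt 33) / 2) = 0 := by
      linarith
    rcases mul_eq_zero.mp hprod with h | h
    · linarith
    · linarith [Real.sqrt_nonneg 33]
  · rintro rfl
    linarith

theorem sqrt_eleven_thirds : Real.sqrt (11 / 3) = Real.sqrt 33 / 3 := by
  rw [Real.sqrt_eq_iff_mul_self_eq (by norm_num) (by positivity)]
  linarith [Real.mul_self_sqrt (show (0 : ℝ) ≤ 33 by norm_num)]

theorem vfun_maximin_point_mem_Icc : (7 - Real.sqrt 33) / 2 ∈ Set.Icc (0 : ℝ) 1 := by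
  have h5 : 5 ≤ Real.sqrt 33 := Real.le_sqrt_of_sq_le (by norm_num)
  have h7 : Real.sqrt 33 ≤ 7 := Real.sqrt_le_iff.mpr (by norm_num)
  constructor <;> linarith

theorem vfun_maximin_point_one :
    vfun ((7 - Real.sqrt 33) / 2) 1 = Real.sqrt (11 / 3) - 1 := by
  have hs : Real.sqrt 33 ^ 2 = 33 := Real.sq_sqrt (by norm_num)
  have h := vfun_maximin_point_mem_Icc.2
  rw [vfun_one_right, sqrt_eleven_thirds, div_eq_iff (by linarith)]
  linarith

theorem vfun_zero_antitoneOn : AntitoneOn (fun x => vfun x 0) (Set.Icc 0 1) := by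
  rintro x ⟨hx, -⟩ y ⟨hy, -⟩ hxy
  simp only [vfun_zero_right]
  rw [div_le_div_iff₀ (by linarith) (by linarith)]
  linarith

theorem vfun_one_monotoneOn : MonotoneOn (fun x => vfun x 1) (Set.Icc 0 1) := by
  rintro x ⟨-, hx⟩ y ⟨-, hy⟩ hxy
  simp only [vfun_one_right]
  rw [div_le_div_iff₀ (by linarith) (by linarith)]
  linarith

/-- core of Lemma A.1: the minimum over `x ∈ [0,1]` of
`max{v(x,0), v(x,1)}` equals `√(11/3) − 1`, attained at `x = (7 − √33)/2`,
which is the unique point of `[0,1]` where `v(x,0) = v(x,1)`. -/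
theorem stmt13 :
    IsLeast {t : ℝ | ∃ x ∈ Set.Icc (0 : ℝ) 1, t = max (vfun x 0) (vfun x 1)}
      (Real.sqrt (11 / 3) - 1) ∧
    max (vfun ((7 - Real.sqrt 33) / 2) 0) (vfun ((7 - Real.sqrt 33) / 2) 1) =
      Real.sqrt (11 / 3) - 1 ∧
    ∀ x ∈ Set.Icc (0 : ℝ) 1,
      (vfun x 0 = vfun x 1 ↔ x = (7 - Real.sqrt 33) / 2) := by
  have hmem := vfun_maximin_point_mem_Icc
  have h1 := vfun_maximin_point_one
  have h0 := ((vfun_zero_eq_vfun_one_iff hmem).mpr rfl).trans h1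
  have hmax : max (vfun ((7 - Real.sqrt 33) / 2) 0) (vfun ((7 - Real.sqrt 33) / 2) 1) =
      Real.sqrt (11 / 3) - 1 := by
    rw [h0, h1, max_self]
  refine ⟨⟨⟨_, hmem, hmax.symm⟩, ?_⟩, hmax, fun x hx => vfun_zero_eq_vfun_one_iff hx⟩
  rintro _ ⟨x, hx, rfl⟩
  rcases le_total x ((7 - Real.sqrt 33) / 2) with h | h
  · exact le_max_of_le_left (h0 ▸ vfun_zero_antitoneOn hx hmem h)
  · exact le_max_of_le_right (h1 ▸ vfun_one_monotoneOn hmem hx h)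
end

section
/- Linearization of the membership test for neigh_β(Φ(𝒱)(s)) (content of Lemma 4.13): Fix a state s ∈ S, a vector 𝐯 ∈ ℝ^{n+1}, β ≥ 0, and a value-set function 𝒱 such that for each s′ ∈ S, 𝒱(s′) is the convex hull of finitely many points, the columns of a matrix M(s′) ∈ ℝ^{(n+1)×L}. Then there exists 𝐯̃ ∈ Φ(𝒱)(s) with ‖𝐯̃ − 𝐯‖_∞ ≤ β if and only if the following system, in variables 𝐯̃ ∈ ℝ^{n+1}, π̄ : 𝐀 → ℝ_{≥0} with Σ_𝐚 π̄(𝐚) = 1, and 𝐳(𝐚,𝐛,s′) ∈ ℝ^L_{≥0} for (𝐚,𝐛,s′) ∈ 𝐀×𝐀×S, is feasible: (i) 𝐯 − β·𝟏 ≤ 𝐯̃ ≤ 𝐯 + β·𝟏 componentwise; (ii) 𝐯̃ = Σ_𝐚 π̄(𝐚)·𝐫(s,𝐚) + γ·Σ_𝐚 Σ_{s′} p(s′|s,𝐚)·M(s′)·𝐳(𝐚,𝐚,s′); (iii) for every agent i ∈ {1,…,n} and all a,b ∈ A: Σ_{𝐚: a_i=a} [π̄(𝐚)·r_i(s,𝐚)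 + γ·Σ_{s′} p(s′|s,𝐚)·M_i(s′)·𝐳(𝐚,𝐚,s′)] ≥ Σ_{𝐚: a_i=a} [π̄(𝐚)·r_i(s,𝐚⊕_i b) + γ·Σ_{s′} p(s′|s,𝐚⊕_i b)·M_i(s′)·𝐳(𝐚,𝐚⊕_i b,s′)], where M_i(s′) is the i-th row of M(s′); (iv) 𝟏·𝐳(𝐚,𝐛,s′) = π̄(𝐚) for all 𝐚,𝐛,s′. -/
open Finset

theorem mem_convexHull_columns_iff {I : Type*} {L : ℕ} (M : I → Fin L → ℝ) (x : I → ℝ) :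
    x ∈ convexHull ℝ {u | ∃ l : Fin L, u = fun i => M i l} ↔
      ∃ c : Fin L → ℝ, (∀ l, 0 ≤ c l) ∧ ∑ l, c l = 1 ∧ ∀ i, x i = ∑ l, M i l * c l := by
  classical
  constructor
  · intro hx
    have hsub : convexHull ℝ {u | ∃ l : Fin L, u = fun i => M i l} ⊆
        {x : I → ℝ | ∃ c : Fin L → ℝ,
          (∀ l, 0 ≤ c l) ∧ ∑ l, c l = 1 ∧ ∀ i, x i = ∑ l, M i l * c l} := by
      refine convexHull_min ?_ ?_
      · rintro _ ⟨l, rfl⟩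
        refine ⟨fun k => if k = l then 1 else 0, fun k => ?_, by simp, fun i => by simp⟩
        dsimp only
        split_ifs <;> norm_num
      · rintro x ⟨c, hc, hc1, hx⟩ y ⟨d, hd, hd1, hy⟩ a b ha hb hab
        refine ⟨fun l => a * c l + b * d l,
          fun l => add_nonneg (mul_nonneg ha (hc l)) (mul_nonneg hb (hd l)), ?_, fun i => ?_⟩
        · rw [sum_add_distrib, ← mul_sum, ← mul_sum, hc1, hd1, mul_one, mul_one, hab]
        · simp only [Pi.add_apply, Pi.smul_apply, smul_eq_mul, hx, hy, mul_sum, mul_add,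
            sum_add_distrib]
          congr 1 <;> exact sum_congr rfl fun l _ => by ring
    exact hsub hx
  · rintro ⟨c, hc, hc1, hx⟩
    have hmem := (convex_convexHull ℝ {u | ∃ l : Fin L, u = fun i => M i l}).sum_mem
      (t := univ) (fun l _ => hc l) hc1
      (fun l _ => subset_convexHull ℝ _ (⟨l, rfl⟩ : ∃ k, (fun i => M i l) = fun i => M i k))
    convert hmem using 1
    ext i
    simp only [hx, Finset.sum_apply, Pi.smul_apply, smul_eq_mul]
    exact sum_congr rfl fun l _ => mul_comm _ _

theorem mul_add_discounted_sum_eq {S : Type*} [Fintype S] {q γ ρ : ℝ} {p w y : S → ℝ}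
    (h : ∀ s, q * w s = y s) :
    q * (ρ + γ * ∑ s, p s * w s) = q * ρ + γ * ∑ s, p s * y s := by
  simp only [← h, mul_add, mul_sum]
  congr 1
  exact sum_congr rfl fun s _ => by ring

/-- Lemma 4.13: with each `𝒱(s')` given as the convex hull of
the `L` columns of a matrix `M(s')`, membership of `v` in the `β`-neighborhood
of `Φ(𝒱)(s)` is equivalent to feasibility of the linearized system (i)–(iv). -/
theorem stmt17 {S A : Type*} [Fintype S] [Fintype A] [DecidableEq A] {n L : ℕ}
    (G : Game S A n) (hG : G.Valid) (s : S) (v : Fin (n + 1) → ℝ)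
    (β : ℝ) (hβ : 0 ≤ β)
    (M : S → Fin (n + 1) → Fin L → ℝ)
    (VS : S → Set (Fin (n + 1) → ℝ))
    (hVS : ∀ s', VS s' = convexHull ℝ {u | ∃ l : Fin L, u = fun i => M s' i l}) :
    (∃ vt ∈ Phi G VS s, ∀ i, |vt i - v i| ≤ β) ↔
    ∃ (vt : Fin (n + 1) → ℝ) (pb : (Fin (n + 1) → A) → ℝ)
      (z : (Fin (n + 1) → A) → (Fin (n + 1) → A) → S → Fin L → ℝ),
      (∀ a, 0 ≤ pb a) ∧ (∑ a : Fin (n + 1) → A, pb a = 1) ∧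
      (∀ a b s' l, 0 ≤ z a b s' l) ∧
      (∀ i, v i - β ≤ vt i ∧ vt i ≤ v i + β) ∧
      (∀ i, vt i = ∑ a : Fin (n + 1) → A, pb a * G.r i s a +
        G.gamma * ∑ a : Fin (n + 1) → A, ∑ s',
          G.p s a s' * ∑ l, M s' i l * z a a s' l) ∧
      (∀ i : Fin (n + 1), i ≠ 0 → ∀ a b : A,
        ∑ av ∈ univ.filter (fun av : Fin (n + 1) → A => av i = a),
            (pb av * G.r i s av +
              G.gamma * ∑ s', G.p s av s' * ∑ l, M s' i l * z av av s' l) ≥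
          ∑ av ∈ univ.filter (fun av : Fin (n + 1) → A => av i = a),
            (pb av * G.r i s (Function.update av i b) +
              G.gamma * ∑ s', G.p s (Function.update av i b) s' *
                ∑ l, M s' i l * z av (Function.update av i b) s' l)) ∧
      (∀ a b s', ∑ l, z a b s' l = pb a) := by
  constructor
  · rintro ⟨vt, ⟨pb, w, ⟨⟨hpb, hpb1⟩, hIC, hw⟩, rfl⟩, hβ'⟩
    simp only [hVS, mem_convexHull_columns_iff] at hw
    choose c hc hc1 hcw using hw
    have key : ∀ a b s' i, pb a * w a b s' i = ∑ l, M s' i l * (pb a * c a b s' l) := by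
      intro a b s' i
      rw [hcw, mul_sum]
      exact sum_congr rfl fun l _ => by ring
    refine ⟨Bellman G s pb w, pb, fun a b s' l => pb a * c a b s' l, hpb, hpb1,
      fun a b s' l => mul_nonneg (hpb a) (hc a b s' l), fun i => ?_, fun i => ?_,
      fun i hi a b => ?_, fun a b s' => ?_⟩
    · have := abs_le.1 (hβ' i)
      constructor <;> linarith
    · rw [mul_sum, ← sum_add_distrib]
      exact sum_congr rfl fun a _ => mul_add_discounted_sum_eq fun s' => key a a s' i
    · have h := hIC i hi a b
      simpa only [mul_add_discounted_sum_eq fun s' => key _ _ s' i] using h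
    · rw [← mul_sum, hc1, mul_one]
  · rintro ⟨vt, pb, z, hpb, hpb1, hz, hvβ, hvt, hIC, hzs⟩
    obtain ⟨l₀⟩ : Nonempty (Fin L) := by
      by_contra hL
      rw [not_nonempty_iff] at hL
      have h0 : ∀ a, pb a = 0 := fun a => by simpa using (hzs a a s).symm
      simp [h0] at hpb1
    have hex : ∀ a b s', ∃ x ∈ VS s', ∀ i, pb a * x i = ∑ l, M s' i l * z a b s' l := by
      intro a b s'
      simp only [hVS, mem_convexHull_columns_iff]
      by_cases h : pb a = 0
      · have hz0 : ∀ l, z a b s' l = 0 := fun l =>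
          (sum_eq_zero_iff_of_nonneg fun k _ => hz a b s' k).1 ((hzs a b s').trans h) l
            (mem_univ l)
        refine ⟨fun i => M s' i l₀, (mem_convexHull_columns_iff _ _).1
          (subset_convexHull ℝ _ ⟨l₀, rfl⟩), fun i => ?_⟩
        simp [h, hz0]
      · refine ⟨fun i => ∑ l, M s' i l * (z a b s' l / pb a),
          ⟨fun l => z a b s' l / pb a, fun l => div_nonneg (hz a b s' l) (hpb a), ?_,
            fun i => rfl⟩, fun i => ?_⟩
        · rw [← sum_div, hzs, div_self h]
        · rw [mul_sum]
          exact sum_congr rfl fun l _ => by field_simp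
    choose w hw key using hex
    refine ⟨vt, ⟨pb, w, ⟨⟨hpb, hpb1⟩, fun i hi a b => ?_, hw⟩, ?_⟩, fun i => ?_⟩
    · have h := hIC i hi a b
      simpa only [mul_add_discounted_sum_eq fun s' => key _ _ s' i] using h
    · ext i
      rw [hvt, mul_sum, ← sum_add_distrib]
      exact sum_congr rfl fun a _ => (mul_add_discounted_sum_eq fun s' => key a a s' i).symm
    · have := hvβ i
      exact abs_le.2 ⟨by linarith, by linarith⟩
end
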